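/- Let m ∈ ℕ and a, b ∈ ℝ∖{0}, and let Φ, Ψ be the linear flows on ℝ^{2m} generated by J_m(a+ib) and by the block-diagonal matrix diag[J_1(a+ib), …, J_1(a+ib)] (m copies), respectively. Then Φ and Ψ are all-Hölder equivalent (Φ ~^{1⁻} Ψ); in fact there exists h ∈ 𝓗_{1⁻}(ℝ^{2m}) with h(Ψ_t x) = Φ_t h(x) for all t ∈ ℝ and x ∈ ℝ^{2m}. -/

import Mathlib

noncomputable section
namespace LF

open Filter Topology

/-- `ℝ^d` with the Euclidean norm. -/
abbrev Euc (d : ℕ) := EuclideanSpace ℝ (Fin d)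

variable {d : ℕ}

/-- The time-`t` map of the linear flow on `ℝ^d` generated by the matrix `A`,
i.e. `x ↦ exp (t A) x`. -/
def linFlow (A : Matrix (Fin d) (Fin d) ℝ) (t : ℝ) (x : Euc d) : Euc d :=
  Matrix.toEuclideanLin (NormedSpace.exp (t • A)) x

/-- The orbit `{Φ_t x : t ∈ ℝ}` of `x` under the linear flow generated by `A`. -/
def flowOrbit (A : Matrix (Fin d) (Fin d) ℝ) (x : Euc d) : Set (Euc d) :=
  Set.range fun t : ℝ => linFlow A t x

/-- `Φ` is `h`-related to `Ψ`: the homeomorphism `h` maps every orbit of the flow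
generated by `A` onto an orbit of the flow generated by `B`. -/
def IsOrbitEquiv (A B : Matrix (Fin d) (Fin d) ℝ) (h : Euc d ≃ₜ Euc d) : Prop :=
  ∀ x : Euc d, h '' flowOrbit A x = flowOrbit B (h x)

/-- `f` satisfies a `β`-Hölder condition on some ball centred at `0`. -/
def HolderNearZero (β : ℝ) (f : Euc d → Euc d) : Prop :=
  ∃ r > (0 : ℝ), ∃ K : ℝ, ∀ x ∈ Metric.ball (0 : Euc d) r, ∀ y ∈ Metric.ball (0 : Euc d) r,
    dist (f x) (f y) ≤ K * dist x y ^ β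

/-- `h ∈ 𝓗_β`: `h 0 = 0` and `h`, `h⁻¹` both satisfy a `β`-Hölder condition near `0`. -/
def MemHolderClass (β : ℝ) (h : Euc d ≃ₜ Euc d) : Prop :=
  h 0 = 0 ∧ HolderNearZero β ⇑h ∧ HolderNearZero β ⇑h.symm

/-- `h ∈ 𝓗_0`: homeomorphisms fixing `0`. -/
def MemH0 (h : Euc d ≃ₜ Euc d) : Prop := h 0 = 0

/-- `h ∈ 𝓗_{0⁺} = ⋃_{γ>0} 𝓗_γ`. -/
def MemH0plus (h : Euc d ≃ₜ Euc d) : Prop := ∃ γ : ℝ, 0 < γ ∧ MemHolderClass γ h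

/-- `h ∈ 𝓗_{1⁻} = ⋂_{0<γ<1} 𝓗_γ`. -/
def MemH1minus (h : Euc d ≃ₜ Euc d) : Prop := ∀ γ : ℝ, 0 < γ → γ < 1 → MemHolderClass γ h

/-- `h ∈ 𝓗_{β⁻} = ⋂_{0<γ<β} 𝓗_γ`. -/
def MemHBelow (β : ℝ) (h : Euc d ≃ₜ Euc d) : Prop :=
  ∀ γ : ℝ, 0 < γ → γ < β → MemHolderClass γ h

/-- `h ∈ 𝓗_{β⁺} = ⋃_{γ>β} 𝓗_γ`. -/
def MemHAbove (β : ℝ) (h : Euc d ≃ₜ Euc d) : Prop :=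
  ∃ γ : ℝ, β < γ ∧ MemHolderClass γ h

/-- `φ ~^⋆ ψ`: `φ` is `h`-related to `ψ` for some `h` in the class `P`. -/
def RelEquivWith (P : (Euc d ≃ₜ Euc d) → Prop) (A B : Matrix (Fin d) (Fin d) ℝ) : Prop :=
  ∃ h : Euc d ≃ₜ Euc d, P h ∧ IsOrbitEquiv A B h

/-- `φ ≃^⋆ ψ`: there are `h` in the class `P` and `α ≠ 0` with
`h (φ t x) = ψ (α t) (h x)` for all `t`, `x`. -/
def SimEquivWith (P : (Euc d ≃ₜ Euc d) → Prop) (A B : Matrix (Fin d) (Fin d) ℝ) : Prop :=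
  ∃ (h : Euc d ≃ₜ Euc d) (α : ℝ), α ≠ 0 ∧ P h ∧
    ∀ (t : ℝ) (x : Euc d), h (linFlow A t x) = linFlow B (α * t) (h x)

/-- The stable set `X_S^Φ = {x : Φ_t x → 0 as t → ∞}`. -/
def stableSet (A : Matrix (Fin d) (Fin d) ℝ) : Set (Euc d) :=
  {x | Tendsto (fun t : ℝ => linFlow A t x) atTop (𝓝 0)}

/-- The unstable set `X_U^Φ = {x : Φ_t x → 0 as t → -∞}`. -/
def unstableSet (A : Matrix (Fin d) (Fin d) ℝ) : Set (Euc d) :=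
  {x | Tendsto (fun t : ℝ => linFlow A t x) atBot (𝓝 0)}

/-- The central set `X_C^Φ = {x : e^{-ε|t|} Φ_t x → 0 as |t| → ∞, for every ε > 0}`. -/
def centralSet (A : Matrix (Fin d) (Fin d) ℝ) : Set (Euc d) :=
  {x | ∀ ε > (0 : ℝ),
    Tendsto (fun t : ℝ => Real.exp (-(ε * |t|)) • linFlow A t x) (atBot ⊔ atTop) (𝓝 0)}

/-- The stable subspace of the flow generated by `A` (the stable set is a subspace,
so taking its span is innocuous). -/
def XS (A : Matrix (Fin d) (Fin d) ℝ) : Submodule ℝ (Euc d) := Submodule.span ℝ (stableSet A)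

/-- The unstable subspace. -/
def XU (A : Matrix (Fin d) (Fin d) ℝ) : Submodule ℝ (Euc d) := Submodule.span ℝ (unstableSet A)

/-- The central subspace. -/
def XC (A : Matrix (Fin d) (Fin d) ℝ) : Submodule ℝ (Euc d) := Submodule.span ℝ (centralSet A)

/-- The hyperbolic subspace `X_H^Φ = X_S^Φ ⊕ X_U^Φ`. -/
def XH (A : Matrix (Fin d) (Fin d) ℝ) : Submodule ℝ (Euc d) := XS A ⊔ XU A

def dimS (A : Matrix (Fin d) (Fin d) ℝ) : ℕ := Module.finrank ℝ (XS A)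
def dimU (A : Matrix (Fin d) (Fin d) ℝ) : ℕ := Module.finrank ℝ (XU A)
def dimHyp (A : Matrix (Fin d) (Fin d) ℝ) : ℕ := Module.finrank ℝ (XH A)

/-- The central-part generators `A^{Φ_C}` and `α A^{Ψ_C}` are similar, i.e.
`Q A_C = (α B_C) Q` for some linear isomorphism `Q : X_C^Φ → X_C^Ψ`. -/
def IsCentralSimilar (A B : Matrix (Fin d) (Fin d) ℝ) (α : ℝ) : Prop :=
  ∃ (hA : ∀ x ∈ XC A, Matrix.toEuclideanLin A x ∈ XC A)
    (hB : ∀ x ∈ XC B, Matrix.toEuclideanLin B x ∈ XC B)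
    (Q : XC A ≃ₗ[ℝ] XC B),
    ∀ x : XC A, Q ((Matrix.toEuclideanLin A).restrict hA x)
      = α • (Matrix.toEuclideanLin B).restrict hB (Q x)

/-- The forward Lyapunov exponent `λ_+^Φ(x) = lim_{t→∞} log ‖Φ_t x‖ / t`
(the limit exists for `x ≠ 0`, so it equals the `limsup` used here). -/
def lyap (A : Matrix (Fin d) (Fin d) ℝ) (x : Euc d) : ℝ :=
  Filter.limsup (fun t : ℝ => Real.log ‖linFlow A t x‖ / t) atTop

/-- The Lyapunov space `L^Φ(s) = {x : λ_+^Φ(x) ≤ s}` (with `λ_+^Φ(0) = -∞`), as a set. -/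
def lyapSet (A : Matrix (Fin d) (Fin d) ℝ) (s : ℝ) : Set (Euc d) :=
  {x | x = 0 ∨ lyap A x ≤ s}

/-- `ℓ^Φ(s) = dim L^Φ(s)` (the Lyapunov set is a subspace, so taking its span is innocuous). -/
def ell (A : Matrix (Fin d) (Fin d) ℝ) (s : ℝ) : ℕ :=
  Module.finrank ℝ (Submodule.span ℝ (lyapSet A s))

/-- The `(j+1)`-st smallest Lyapunov exponent `λ_{j+1}^Φ`, counted with multiplicity. -/
def lyapExp (A : Matrix (Fin d) (Fin d) ℝ) (j : ℕ) : ℝ :=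
  sInf {s : ℝ | j + 1 ≤ ell A s}

/-- The Lyapunov space at `s` of the restriction of the flow to the invariant set `V`. -/
def lyapSetIn (A : Matrix (Fin d) (Fin d) ℝ) (V : Set (Euc d)) (s : ℝ) : Set (Euc d) :=
  {x | x ∈ V ∧ (x = 0 ∨ lyap A x ≤ s)}

def ellIn (A : Matrix (Fin d) (Fin d) ℝ) (V : Set (Euc d)) (s : ℝ) : ℕ :=
  Module.finrank ℝ (Submodule.span ℝ (lyapSetIn A V s))

/-- The `(j+1)`-st smallest Lyapunov exponent of the flow restricted to `V`. -/
def lyapExpIn (A : Matrix (Fin d) (Fin d) ℝ) (V : Set (Euc d)) (j : ℕ) : ℝ :=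
  sInf {s : ℝ | j + 1 ≤ ellIn A V s}

/-- `λ_{j+1}^{Φ_H}`: the `(j+1)`-st smallest Lyapunov exponent of the restriction
of the flow to the hyperbolic subspace. -/
def lyapExpH (A : Matrix (Fin d) (Fin d) ℝ) (j : ℕ) : ℝ :=
  lyapExpIn A (XH A) j

/-- The flow generated by `A` is stable: every orbit tends to `0` as `t → ∞`. -/
def IsStable (A : Matrix (Fin d) (Fin d) ℝ) : Prop := ∀ x : Euc d, x ∈ stableSet A

/-- The flow generated by `A` is unstable: every orbit tends to `0` as `t → -∞`. -/
def IsUnstable (A : Matrix (Fin d) (Fin d) ℝ) : Prop := ∀ x : Euc d, x ∈ unstableSet A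

/-- The flow generated by `A` is hyperbolic: `X = X_S ⊕ X_U`. -/
def IsHyperbolic (A : Matrix (Fin d) (Fin d) ℝ) : Prop := IsCompl (XS A) (XU A)

/-- `ρ_+(Φ,Ψ) = (min_j λ_j^Φ/λ_j^Ψ) / |max_j λ_j^Φ/λ_j^Ψ|`. -/
def rhoPlus (A B : Matrix (Fin d) (Fin d) ℝ) : ℝ :=
  (⨅ j : Fin d, lyapExp A j / lyapExp B j) / |⨆ j : Fin d, lyapExp A j / lyapExp B j|

/-- The Lyapunov cross ratio `ρ(Φ,Ψ) = max {ρ_+(Φ,Ψ), ρ_+(Φ*,Ψ)}`, where `Φ*` is the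
time-reversal of `Φ`, generated by `-A`. -/
def rho (A B : Matrix (Fin d) (Fin d) ℝ) : ℝ := max (rhoPlus A B) (rhoPlus (-A) B)

/-- The minimal period `T_x^Φ = inf {t > 0 : Φ_t x = x} ∈ [0,∞]` (with `inf ∅ = ∞`). -/
def minPeriod (A : Matrix (Fin d) (Fin d) ℝ) (x : Euc d) : EReal :=
  sInf {T : EReal | ∃ t : ℝ, 0 < t ∧ linFlow A t x = x ∧ T = (t : EReal)}

/-- The set of complex eigenvalues of the real matrix `A`. -/
def cSpec {n : ℕ} (A : Matrix (Fin n) (Fin n) ℝ) : Set ℂ :=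
  spectrum ℂ (A.map Complex.ofReal)

/-- `x` is a fixed point of the flow generated by `A`. -/
def IsFixedPt (A : Matrix (Fin d) (Fin d) ℝ) (x : Euc d) : Prop :=
  ∀ t : ℝ, linFlow A t x = x

/-- The nilpotent `m × m` Jordan block `J_m` (ones on the superdiagonal). -/
def jordanNil (m : ℕ) : Matrix (Fin m) (Fin m) ℝ :=
  Matrix.of fun i j => if (i : ℕ) + 1 = (j : ℕ) then 1 else 0

def sum2Equiv (m : ℕ) : (Fin m ⊕ Fin m) ≃ Fin (2 * m) :=
  finSumFinEquiv.trans (finCongr (two_mul m).symm)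

/-- The real Jordan block `J_m(a+ib) = a I_{2m} + [[J_m, -bI_m],[bI_m, J_m]]`,
as a `2m × 2m` real matrix. -/
def jordanC (m : ℕ) (a b : ℝ) : Matrix (Fin (2 * m)) (Fin (2 * m)) ℝ :=
  Matrix.reindex (sum2Equiv m) (sum2Equiv m)
    (a • (1 : Matrix (Fin m ⊕ Fin m) (Fin m ⊕ Fin m) ℝ) +
      Matrix.fromBlocks (jordanNil m) (-b • (1 : Matrix (Fin m) (Fin m) ℝ))
        (b • (1 : Matrix (Fin m) (Fin m) ℝ)) (jordanNil m))

/-- The block-diagonal matrix `diag [J_1(a+ib), …, J_1(a+ib)]` (`m` copies of the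
`2 × 2` block `[[a,-b],[b,a]]`), as a `2m × 2m` real matrix. -/
def diagJ1C (m : ℕ) (a b : ℝ) : Matrix (Fin (2 * m)) (Fin (2 * m)) ℝ :=
  Matrix.reindex finProdFinEquiv finProdFinEquiv
    (Matrix.blockDiagonal fun _ : Fin m => !![a, -b; b, a])


/-- `f` is Hölder on bounded sets for every exponent below one. -/
def AH {X Y : Type*} [NormedAddCommGroup X] [NormedAddCommGroup Y] (f : X → Y) : Prop :=
  ∀ α : ℝ, 0 < α → α < 1 → ∀ R : ℝ, 0 < R → ∃ K : ℝ, 0 ≤ K ∧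
    ∀ x y : X, ‖x‖ ≤ R → ‖y‖ ≤ R → ‖f x - f y‖ ≤ K * ‖x - y‖ ^ α

section AHsec
variable {X Y Z : Type*} [NormedAddCommGroup X] [NormedAddCommGroup Y] [NormedAddCommGroup Z]

lemma AH.of_lip {f : X → Y} (C : ℝ) (hC : 0 ≤ C) (h : ∀ x y, ‖f x - f y‖ ≤ C * ‖x - y‖) : AH f := by
  intro α h0 h1 R hR
  refine ⟨C * (2 * R) ^ (1 - α), by positivity, fun x y hx hy => (h x y).trans ?_⟩
  rw [mul_assoc]
  refine mul_le_mul_of_nonneg_left ?_ hC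
  rcases (norm_nonneg (x - y)).eq_or_lt with h' | h'
  · rw [← h']; positivity
  · calc ‖x - y‖ = ‖x - y‖ ^ (1 - α) * ‖x - y‖ ^ α := by
          rw [← Real.rpow_add h']; simp
      _ ≤ _ := by
          gcongr
          exact (norm_sub_le x y).trans (by linarith)

lemma AH.add {f g : X → Y} (hf : AH f) (hg : AH g) : AH (fun x => f x + g x) := by
  intro α h0 h1 R hR
  obtain ⟨K, hK, h⟩ := hf α h0 h1 R hR
  obtain ⟨K', hK', h'⟩ := hg α h0 h1 R hR
  refine ⟨K + K', by positivity, fun x y hx hy => ?_⟩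
  have e : f x + g x - (f y + g y) = (f x - f y) + (g x - g y) := by abel
  rw [e, add_mul]
  exact (norm_add_le _ _).trans (add_le_add (h x y hx hy) (h' x y hx hy))

lemma AH.zero : AH (fun _ : X => (0 : Y)) := AH.of_lip 0 le_rfl (by simp)

lemma AH.sum {ι : Type*} (s : Finset ι) {f : ι → X → Y} (hf : ∀ i, AH (f i)) :
    AH (fun x => ∑ i ∈ s, f i x) := by
  classical
  induction s using Finset.induction_on with
  | empty => simpa using AH.zero
  | insert i s hi ih =>
    simp only [Finset.sum_insert hi]
    exact (hf i).add ih

lemma sqrt_facts {α : ℝ} (h0 : 0 < α) (h1 : α < 1) :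
    0 < √α ∧ √α < 1 ∧ √α * √α = α ∧ α < √α := by
  have a0 := Real.sqrt_pos.2 h0
  have a1 : √α < 1 := by rw [Real.sqrt_lt' one_pos]; simpa using h1
  have a2 := Real.mul_self_sqrt h0.le
  exact ⟨a0, a1, a2, by nlinarith⟩

lemma AH.bdd {f : X → Y} (hf : AH f) (R : ℝ) (hR : 0 < R) :
    ∃ M : ℝ, 0 < M ∧ ∀ x, ‖x‖ ≤ R → ‖f x‖ ≤ M := by
  obtain ⟨K, hK, h⟩ := hf (1/2) (by norm_num) (by norm_num) R hR
  refine ⟨‖f 0‖ + K * R ^ (1/2 : ℝ) + 1, by positivity, fun x hx => ?_⟩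
  have := h x 0 hx (by simpa using hR.le)
  rw [sub_zero] at this
  have h2 : K * ‖x‖ ^ (1/2 : ℝ) ≤ K * R ^ (1/2 : ℝ) := by gcongr
  have h3 := norm_sub_norm_le (f x) (f 0)
  linarith

lemma AH.comp {f : Y → Z} {g : X → Y} (hf : AH f) (hg : AH g) : AH (fun x => f (g x)) := by
  intro α h0 h1 R hR
  obtain ⟨a0, a1, a2, -⟩ := sqrt_facts h0 h1
  obtain ⟨M, hM, hb⟩ := hg.bdd R hR
  obtain ⟨K, hK, h⟩ := hg _ a0 a1 R hR
  obtain ⟨K', hK', h'⟩ := hf _ a0 a1 M hM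
  refine ⟨K' * K ^ √α, by positivity, fun x y hx hy => ?_⟩
  calc _ ≤ _ := h' _ _ (hb x hx) (hb y hy)
    _ ≤ K' * (K * ‖x - y‖ ^ √α) ^ √α := by gcongr; exact h x y hx hy
    _ = _ := by
      rw [Real.mul_rpow hK (by positivity), ← Real.rpow_mul (norm_nonneg _), a2, mul_assoc]

lemma AH.continuous {f : X → Y} (hf : AH f) : Continuous f := by
  rw [continuous_iff_continuousAt]
  intro x
  obtain ⟨K, hK, h⟩ := hf (1/2) (by norm_num) (by norm_num) (‖x‖ + 1) (by positivity)
  rw [ContinuousAt, tendsto_iff_norm_sub_tendsto_zero]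
  have lim : Tendsto (fun y : X => K * ‖y - x‖ ^ (1/2 : ℝ)) (𝓝 x) (𝓝 0) := by
    have : Continuous (fun y : X => K * ‖y - x‖ ^ (1/2 : ℝ)) :=
      continuous_const.mul ((continuous_id.sub continuous_const).norm.rpow_const
        (fun _ => Or.inr (by norm_num)))
    simpa using this.tendsto x
  refine squeeze_zero' (Eventually.of_forall fun _ => norm_nonneg _) ?_ lim
  filter_upwards [Metric.ball_mem_nhds x one_pos] with y hy
  rw [Metric.mem_ball, dist_eq_norm] at hy
  refine h y x ?_ (by linarith)
  have := norm_sub_norm_le y x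
  linarith

lemma log_rpow_bdd (ε M : ℝ) (hε : 0 < ε) : ∃ B : ℝ, 0 ≤ B ∧ ∀ p, 0 ≤ p → p ≤ M →
    |Real.log p| * p ^ ε ≤ B := by
  refine ⟨1 / ε + |M| ^ ε / ε * |M| ^ ε, by positivity, fun p hp hpM => ?_⟩
  have hpM' : p ≤ |M| := hpM.trans (le_abs_self _)
  rcases hp.eq_or_lt with rfl | hp'
  · simp; positivity
  rcases le_total p 1 with h1 | h1
  · have := Real.abs_log_mul_self_rpow_lt p ε hp' h1 hε
    rw [abs_mul, abs_of_nonneg (Real.rpow_nonneg hp ε)] at this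
    have : 0 ≤ |M| ^ ε / ε * |M| ^ ε := by positivity
    linarith
  · rw [abs_of_nonneg (Real.log_nonneg h1)]
    have h2 := Real.log_le_rpow_div hp hε
    have h3 : p ^ ε ≤ |M| ^ ε := by gcongr
    have : Real.log p * p ^ ε ≤ |M| ^ ε / ε * |M| ^ ε := by
      gcongr
      exact h2.trans (by gcongr)
    have : 0 ≤ 1 / ε := by positivity
    linarith

lemma log_one_add_le (s β : ℝ) (hs : 0 ≤ s) (h0 : 0 < β) (h1 : β ≤ 1) :
    Real.log (1 + s) ≤ s ^ β / β := by
  rw [le_div_iff₀ h0, mul_comm, ← Real.log_rpow (by linarith)]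
  have h2 : (1 + s) ^ β ≤ 1 + s ^ β := by
    simpa using Real.rpow_add_le_add_rpow zero_le_one hs h0.le h1
  have h3 : 0 < (1 + s) ^ β := by positivity
  have := Real.log_le_sub_one_of_pos h3
  linarith

/-- `v` is dominated by every power below one of `u`, on bounded sets. -/
def Dom (u : X → Y) (v : X → ℂ) : Prop :=
  ∀ α : ℝ, 0 < α → α < 1 → ∀ R : ℝ, 0 < R → ∃ K : ℝ, 0 ≤ K ∧
    ∀ x : X, ‖x‖ ≤ R → ‖v x‖ ≤ K * ‖u x‖ ^ α

lemma Dom.log_mul {u : X → Y} {v : X → ℂ} (hu : AH u) (h : Dom u v) :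
    Dom u (fun x => (Real.log ‖u x‖ : ℂ) * v x) := by
  intro α h0 h1 R hR
  obtain ⟨a0, a1, a2, a3⟩ := sqrt_facts h0 h1
  obtain ⟨M, hM, hb⟩ := hu.bdd R hR
  obtain ⟨K, hK, h⟩ := h _ a0 a1 R hR
  obtain ⟨B, hB, h'⟩ := log_rpow_bdd (√α - α) M (by linarith)
  refine ⟨K * B, by positivity, fun x hx => ?_⟩
  rw [norm_mul, Complex.norm_real, Real.norm_eq_abs]
  have e : ‖u x‖ ^ √α = ‖u x‖ ^ (√α - α) * ‖u x‖ ^ α := by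
    rw [← Real.rpow_add_of_nonneg (norm_nonneg _) (by linarith) h0.le]; ring_nf
  calc _ ≤ |Real.log ‖u x‖| * (K * ‖u x‖ ^ √α) := by gcongr; exact h x hx
    _ = K * (|Real.log ‖u x‖| * ‖u x‖ ^ (√α - α)) * ‖u x‖ ^ α := by rw [e]; ring
    _ ≤ _ := by gcongr; exact h' _ (norm_nonneg _) (hb x hx)

lemma AH.log_mul {u : X → Y} {v : X → ℂ} (hu : AH u) (hv : AH v) (h : Dom u v) :
    AH (fun x => (Real.log ‖u x‖ : ℂ) * v x) := by
  intro γ h0 h1 R hR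
  obtain ⟨a0, a1, a2, a3⟩ := sqrt_facts h0 h1
  set α := √γ
  obtain ⟨M, hM, hb⟩ := hu.bdd R hR
  obtain ⟨C, hC, hd⟩ := h _ a0 a1 R hR
  obtain ⟨K, hK, hk⟩ := hu _ a0 a1 R hR
  obtain ⟨K', hK', hk'⟩ := hv _ a0 a1 R hR
  obtain ⟨B, hB, hlog⟩ := log_rpow_bdd (α * (1 - α)) M (mul_pos a0 (by linarith))
  set T := B * (2 * C) ^ (1 - α) * K' ^ α + C / α * K ^ α
  have key : ∀ x y : X, ‖x‖ ≤ R → ‖y‖ ≤ R → ‖u y‖ ≤ ‖u x‖ →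
      ‖(Real.log ‖u x‖ : ℂ) * v x - (Real.log ‖u y‖ : ℂ) * v y‖ ≤ T * ‖x - y‖ ^ γ := by
    intro x y hx hy hq
    have e : (Real.log ‖u x‖ : ℂ) * v x - (Real.log ‖u y‖ : ℂ) * v y
        = (Real.log ‖u x‖ : ℂ) * (v x - v y)
          + ((Real.log ‖u x‖ - Real.log ‖u y‖ : ℝ) : ℂ) * v y := by push_cast; ring
    rw [e, add_mul]
    refine (norm_add_le _ _).trans (add_le_add ?_ ?_)
    · rw [norm_mul, Complex.norm_real, Real.norm_eq_abs]
      have n0 := norm_nonneg (v x - v y)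
      have hv1 : ‖v x - v y‖ ≤ 2 * C * ‖u x‖ ^ α := by
        have h1 := hd x hx
        have h2 := hd y hy
        have h3 : C * ‖u y‖ ^ α ≤ C * ‖u x‖ ^ α := by gcongr
        have := norm_sub_le (v x) (v y)
        linarith
      have e2 : ‖v x - v y‖ = ‖v x - v y‖ ^ (1 - α) * ‖v x - v y‖ ^ α := by
        rw [← Real.rpow_add_of_nonneg n0 (by linarith) a0.le]; simp
      have h5 : ‖v x - v y‖ ≤ (2 * C * ‖u x‖ ^ α) ^ (1 - α) * (K' * ‖x - y‖ ^ α) ^ α := by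
        rw [e2]
        have := hk' x y hx hy
        gcongr
      rw [Real.mul_rpow (x := 2 * C) (by positivity) (by positivity), ← Real.rpow_mul (norm_nonneg _),
        Real.mul_rpow (x := K') (by positivity) (by positivity), ← Real.rpow_mul (norm_nonneg _), a2] at h5
      calc _ ≤ _ := mul_le_mul_of_nonneg_left h5 (abs_nonneg _)
        _ = (|Real.log ‖u x‖| * ‖u x‖ ^ (α * (1 - α))) * (2 * C) ^ (1 - α) * K' ^ α
              * ‖x - y‖ ^ γ := by ring
        _ ≤ _ := by gcongr; exact hlog _ (norm_nonneg _) (hb x hx)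
    · rw [norm_mul, Complex.norm_real, Real.norm_eq_abs]
      have h2 := hd y hy
      rcases (norm_nonneg (u y)).eq_or_lt with hz | hz
      · rw [← hz, Real.zero_rpow a0.ne', mul_zero] at h2
        have : ‖v y‖ = 0 := le_antisymm h2 (norm_nonneg _)
        rw [this, mul_zero]; positivity
      · have hp : 0 < ‖u x‖ := hz.trans_le hq
        rw [abs_of_nonneg (sub_nonneg.2 (Real.log_le_log hz hq)), ← Real.log_div hp.ne' hz.ne']
        have e3 : ‖u x‖ / ‖u y‖ = 1 + (‖u x‖ - ‖u y‖) / ‖u y‖ := by field_simp; ring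
        have hs : 0 ≤ ‖u x‖ - ‖u y‖ := sub_nonneg.2 hq
        have h6 := log_one_add_le ((‖u x‖ - ‖u y‖) / ‖u y‖) α (by positivity) a0 a1.le
        rw [← e3, Real.div_rpow hs hz.le] at h6
        have h7 : ‖u x‖ - ‖u y‖ ≤ K * ‖x - y‖ ^ α :=
          (norm_sub_norm_le _ _).trans (hk x y hx hy)
        have h8 : (‖u x‖ - ‖u y‖) ^ α ≤ K ^ α * ‖x - y‖ ^ γ := by
          have : (‖u x‖ - ‖u y‖) ^ α ≤ (K * ‖x - y‖ ^ α) ^ α := by gcongr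
          rwa [Real.mul_rpow (by positivity) (by positivity), ← Real.rpow_mul (norm_nonneg _),
            a2] at this
        have hpow : 0 < ‖u y‖ ^ α := by positivity
        calc _ ≤ (‖u x‖ - ‖u y‖) ^ α / ‖u y‖ ^ α / α * (C * ‖u y‖ ^ α) := by
              gcongr
          _ = C / α * (‖u x‖ - ‖u y‖) ^ α := by field_simp
          _ ≤ C / α * (K ^ α * ‖x - y‖ ^ γ) := by gcongr
          _ = _ := by ring
  refine ⟨T, by positivity, fun x y hx hy => ?_⟩
  rcases le_total ‖u y‖ ‖u x‖ with hq | hq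
  · exact key x y hx hy hq
  · rw [norm_sub_rev, norm_sub_rev x y]; exact key y x hy hx hq

lemma AH.log_pow_mul {u : X → Y} {v : X → ℂ} (hu : AH u) (hv : AH v) (h : Dom u v) (n : ℕ) :
    AH (fun x => (Real.log ‖u x‖ : ℂ) ^ n * v x) := by
  have : AH (fun x => (Real.log ‖u x‖ : ℂ) ^ n * v x) ∧
      Dom u (fun x => (Real.log ‖u x‖ : ℂ) ^ n * v x) := by
    induction n with
    | zero => simpa using ⟨hv, h⟩
    | succ n ih =>
      simp only [pow_succ', mul_assoc]
      exact ⟨AH.log_mul hu ih.1 ih.2, Dom.log_mul hu ih.2⟩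
  exact this.1

lemma AH.const_mul {v : X → ℂ} (hv : AH v) (c : ℂ) : AH (fun x => c * v x) :=
  AH.comp (f := fun z : ℂ => c * z)
    (AH.of_lip ‖c‖ (norm_nonneg _) (fun x y => by rw [← mul_sub, norm_mul])) hv

lemma AH.pi {m : ℕ} {f : X → Fin m → ℂ} (h : ∀ k, AH (fun x => f x k)) : AH f := by
  intro α h0 h1 R hR
  choose K hK hb using fun k => h k α h0 h1 R hR
  refine ⟨∑ k, K k, Finset.sum_nonneg fun k _ => hK k, fun x y hx hy => ?_⟩
  rw [pi_norm_le_iff_of_nonneg (mul_nonneg (Finset.sum_nonneg fun k _ => hK k) (by positivity))]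
  intro k
  refine (hb k x y hx hy).trans ?_
  gcongr
  exact Finset.single_le_sum (f := K) (fun k _ => hK k) (Finset.mem_univ k)

lemma AH.apply {m : ℕ} (k : Fin m) : AH (fun x : Fin m → ℂ => x k) :=
  AH.of_lip 1 zero_le_one (fun x y => by simpa using norm_le_pi_norm (x - y) k)

lemma AH.tail {m : ℕ} : AH (fun x : Fin (m + 1) → ℂ => (Fin.tail x : Fin m → ℂ)) :=
  AH.pi fun k => AH.apply k.succ

end AHsec

/-- divided powers -/
noncomputable def dpw (n : ℕ) (t : ℝ) : ℂ := (t : ℂ) ^ n / (n.factorial : ℂ)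

lemma dpw_add (n : ℕ) (s t : ℝ) :
    dpw n (s + t) = ∑ i ∈ Finset.range (n + 1), dpw i s * dpw (n - i) t := by
  unfold dpw
  push_cast
  rw [add_pow, Finset.sum_div]
  refine Finset.sum_congr rfl fun i hi => ?_
  have hi' : i ≤ n := Nat.lt_succ_iff.1 (Finset.mem_range.1 hi)
  rw [Nat.cast_choose ℂ hi']
  have h1 : (n.factorial : ℂ) ≠ 0 := by exact_mod_cast n.factorial_ne_zero
  have h2 : (i.factorial : ℂ) ≠ 0 := by exact_mod_cast i.factorial_ne_zero
  have h3 : ((n - i).factorial : ℂ) ≠ 0 := by exact_mod_cast (n - i).factorial_ne_zero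
  field_simp

/-- exponential of the nilpotent Jordan block -/
noncomputable def nilP {m : ℕ} (t : ℝ) (v : Fin m → ℂ) : Fin m → ℂ :=
  fun k => ∑ j : Fin m, if k ≤ j then dpw (j - k) t * v j else 0

noncomputable def qf {m : ℕ} (t : ℝ) (v : Fin m → ℂ) : ℂ := ∑ j : Fin m, dpw (j + 1) t * v j

lemma nilP_cons {m : ℕ} (t : ℝ) (w : ℂ) (v : Fin m → ℂ) :
    nilP t (Fin.cons w v : Fin (m + 1) → ℂ) = Fin.cons (w + qf t v) (nilP t v) := by
  funext k
  refine Fin.cases ?_ (fun k => ?_) k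
  · simp [nilP, qf, Fin.sum_univ_succ, dpw]
  · simp [nilP, Fin.sum_univ_succ]

lemma qf_cocycle {m : ℕ} (s t : ℝ) (v : Fin m → ℂ) :
    qf s (nilP t v) + qf t v = qf (s + t) v := by
  unfold qf nilP
  simp only [Finset.mul_sum]
  rw [Finset.sum_comm, ← Finset.sum_add_distrib]
  refine Finset.sum_congr rfl fun j _ => ?_
  rw [dpw_add, Finset.sum_range_succ']
  have : ∑ k : Fin m, dpw (k + 1) s * (if k ≤ j then dpw (j - k) t * v j else 0)
      = ∑ k ∈ Finset.range (j + 1), dpw (k + 1) s * dpw ((j : ℕ) + 1 - (k + 1)) t * v j := by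
    have e := Fin.sum_univ_eq_sum_range
      (fun k => dpw (k + 1) s * (if k ≤ (j : ℕ) then dpw (j - k) t * v j else 0)) m
    simp only [Fin.le_def]
    rw [e, ← Finset.sum_subset (s₁ := Finset.range (j + 1))]
    · refine Finset.sum_congr rfl fun k hk => ?_
      rw [if_pos (Nat.lt_succ_iff.1 (Finset.mem_range.1 hk)), Nat.add_sub_add_right, mul_assoc]
    · intro k hk
      have := j.2
      simp at *; omega
    · intro k _ hk
      rw [if_neg (by simpa using hk), mul_zero]
  rw [this, ← Finset.sum_mul]
  simp [dpw]
  ring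

lemma norm_cexp_mul (a b t : ℝ) : ‖Complex.exp ((a + b * Complex.I) * t)‖ = Real.exp (a * t) := by
  rw [Complex.norm_exp]; simp

/-- the correction term -/
noncomputable def corr {m : ℕ} (a : ℝ) (y v : Fin m → ℂ) : ℂ := qf (-(a⁻¹ * Real.log ‖y‖)) v

lemma corr_AH {X : Type*} [NormedAddCommGroup X] {m : ℕ} (a : ℝ) {u v : X → Fin m → ℂ}
    (hu : AH u) (hv : AH v) (h : ∀ k, Dom u (fun x => v x k)) :
    AH (fun x => corr a (u x) (v x)) := by
  unfold corr qf
  refine AH.sum _ fun j => ?_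
  have := (AH.log_pow_mul hu ((AH.apply j).comp hv) (h j) (j + 1)).const_mul
    ((-(a⁻¹ : ℂ)) ^ ((j : ℕ) + 1) / (((j : ℕ) + 1).factorial : ℂ))
  refine (congrArg AH ?_).mp this
  funext x
  unfold dpw
  push_cast
  rw [← neg_mul, mul_pow]
  ring

lemma Dom_of_AH {X : Type*} [NormedAddCommGroup X] {m : ℕ} {u : X → Fin m → ℂ}
    {G : (Fin m → ℂ) → Fin m → ℂ} (hu : AH u) (hG : AH G) (hG0 : G 0 = 0) (k : Fin m) :
    Dom u (fun x => G (u x) k) := by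
  intro α h0 h1 R hR
  obtain ⟨M, hM, hb⟩ := hu.bdd R hR
  obtain ⟨K, hK, h⟩ := hG α h0 h1 M hM
  refine ⟨K, hK, fun x hx => ?_⟩
  have := h (u x) 0 (hb x hx) (by simpa using hM.le)
  rw [hG0, sub_zero, sub_zero] at this
  exact (norm_le_pi_norm _ k).trans this

theorem exists_conj (a b : ℝ) (ha : a ≠ 0) (m : ℕ) :
    ∃ H : (Fin m → ℂ) ≃ (Fin m → ℂ), H 0 = 0 ∧ AH H ∧ AH H.symm ∧
      ∀ (t : ℝ) (y : Fin m → ℂ), H (Complex.exp ((a + b * Complex.I) * t) • y)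
        = Complex.exp ((a + b * Complex.I) * t) • nilP t (H y) := by
  induction m with
  | zero => exact ⟨Equiv.refl _, rfl, AH.pi fun k => k.elim0, AH.pi fun k => k.elim0,
      fun t y => Subsingleton.elim _ _⟩
  | succ m ih =>
    obtain ⟨H, H0, hH, hHs, hc⟩ := ih
    have Hs0 : H.symm 0 = 0 := by rw [Equiv.symm_apply_eq, H0]
    let F : (Fin m → ℂ) → ℂ := fun y => corr a y (H y)
    have hid : AH (fun y : Fin m → ℂ => y) := AH.of_lip 1 zero_le_one (by simp)
    have hF : AH F := corr_AH a hid hH (fun k => Dom_of_AH hid hH H0 k)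
    have hFs : AH (fun y => F (H.symm y)) := by
      have := corr_AH a hHs (hH.comp hHs) (fun k => Dom_of_AH hHs hH H0 k)
      exact this
    have hFc : ∀ (t : ℝ) (y : Fin m → ℂ), F (Complex.exp ((a + b * Complex.I) * t) • y)
        = Complex.exp ((a + b * Complex.I) * t) * (F y - qf t (H y)) := by
      intro t y
      by_cases hy : y = 0
      · subst hy
        simp [F, corr, H0, qf]
      · have hq : ∀ (s : ℝ) (c : ℂ) (v : Fin m → ℂ), qf s (c • v) = c * qf s v := by
          intro s c v
          simp only [qf, Finset.mul_sum, Pi.smul_apply, smul_eq_mul]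
          exact Finset.sum_congr rfl fun j _ => by ring
        simp only [F, corr]
        rw [hc, hq, norm_smul, norm_cexp_mul, Real.log_mul (Real.exp_ne_zero _)
          (norm_ne_zero_iff.2 hy), Real.log_exp]
        have := qf_cocycle (-(a⁻¹ * (a * t + Real.log ‖y‖))) t (H y)
        have e : -(a⁻¹ * (a * t + Real.log ‖y‖)) + t = -(a⁻¹ * Real.log ‖y‖) := by
          field_simp; ring
        rw [e] at this
        rw [← this]; ring
    let H' : (Fin (m + 1) → ℂ) ≃ (Fin (m + 1) → ℂ) :=
      { toFun := fun y => Fin.cons (y 0 - F (Fin.tail y)) (H (Fin.tail y))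
        invFun := fun y => Fin.cons (y 0 + F (H.symm (Fin.tail y))) (H.symm (Fin.tail y))
        left_inv := fun y => by simp
        right_inv := fun y => by simp }
    refine ⟨H', ?_, AH.pi fun k => ?_, AH.pi fun k => ?_, fun t y => ?_⟩
    · have h0 : F 0 = 0 := by simp [F, corr, H0, qf]
      have ht : (Fin.tail (0 : Fin (m + 1) → ℂ)) = 0 := rfl
      funext k
      refine Fin.cases ?_ (fun k => ?_) k
      · simp [H', ht, h0]
      · simp [H', ht, H0]
    · refine Fin.cases ?_ (fun k => ?_) k
      · have := (AH.apply (0 : Fin (m + 1))).add ((hF.comp AH.tail).const_mul (-1))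
        refine (congrArg AH ?_).mp this
        funext x; simp [H']; ring
      · exact (AH.apply k).comp (hH.comp AH.tail)
    · refine Fin.cases ?_ (fun k => ?_) k
      · exact (AH.apply (0 : Fin (m + 1))).add (hFs.comp AH.tail)
      · exact (AH.apply k).comp (hHs.comp AH.tail)
    · have ht : Fin.tail (Complex.exp ((a + b * Complex.I) * t) • y)
          = Complex.exp ((a + b * Complex.I) * t) • Fin.tail y := rfl
      change (Fin.cons _ _ : Fin (m + 1) → ℂ) = _ • nilP t (Fin.cons _ _)
      rw [nilP_cons, ht, hFc, hc]
      funext k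
      refine Fin.cases ?_ (fun k => ?_) k
      · simp; ring
      · simp


/-- the real-linear identification of `ℂ^m` with `ℝ^{2m}` -/
def toE (m : ℕ) : (Fin m → ℂ) ≃ₗ[ℝ] Euc (2 * m) where
  toFun z := WithLp.toLp 2 fun i =>
    Sum.elim (fun k => (z k).re) (fun k => (z k).im) ((sum2Equiv m).symm i)
  invFun x := fun k => ⟨x (sum2Equiv m (Sum.inl k)), x (sum2Equiv m (Sum.inr k))⟩
  map_add' x y := by
    ext i
    obtain ⟨j, rfl⟩ := (sum2Equiv m).surjective i
    rcases j with j | j <;> simp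
  map_smul' c y := by
    ext i
    obtain ⟨j, rfl⟩ := (sum2Equiv m).surjective i
    rcases j with j | j <;> simp
  left_inv z := by funext k; simp
  right_inv x := by
    ext i
    obtain ⟨j, rfl⟩ := (sum2Equiv m).surjective i
    rcases j with j | j <;> simp

lemma jordanC_toE (m : ℕ) (a b : ℝ) (z : Fin m → ℂ) :
    Matrix.toEuclideanLin (jordanC m a b) (toE m z) = toE m (fun k =>
      (a + b * Complex.I) * z k + ∑ j : Fin m, if (k : ℕ) + 1 = j then z j else 0) := by
  ext i
  obtain ⟨j, rfl⟩ := (sum2Equiv m).surjective i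
  simp only [Matrix.toLpLin_apply, Matrix.mulVec, dotProduct]
  rw [← (sum2Equiv m).sum_comp]
  rcases j with j | j <;>
  simp [toE, jordanC, Matrix.fromBlocks, jordanNil, Matrix.one_apply, Finset.sum_add_distrib,
    add_mul, ite_mul, apply_ite Complex.re, apply_ite Complex.im] <;> ring

lemma diagJ1C_eq (m : ℕ) (a b : ℝ) : diagJ1C m a b =
    Matrix.reindex (sum2Equiv m) (sum2Equiv m)
    (a • (1 : Matrix (Fin m ⊕ Fin m) (Fin m ⊕ Fin m) ℝ) +
      Matrix.fromBlocks 0 (-b • (1 : Matrix (Fin m) (Fin m) ℝ))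
        (b • (1 : Matrix (Fin m) (Fin m) ℝ)) 0) := by
  have h1 : ∀ k : Fin m, finProdFinEquiv.symm (sum2Equiv m (Sum.inl k)) = ((0 : Fin 2), k) := by
    intro k
    rw [Equiv.symm_apply_eq]
    ext
    simp [sum2Equiv, finProdFinEquiv]
  have h2 : ∀ k : Fin m, finProdFinEquiv.symm (sum2Equiv m (Sum.inr k)) = ((1 : Fin 2), k) := by
    intro k
    rw [Equiv.symm_apply_eq]
    ext
    simp [sum2Equiv, finProdFinEquiv, add_comm]
  ext i j
  obtain ⟨i, rfl⟩ := (sum2Equiv m).surjective i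
  obtain ⟨j, rfl⟩ := (sum2Equiv m).surjective j
  rcases i with i | i <;> rcases j with j | j <;>
  simp [diagJ1C, h1, h2, Matrix.blockDiagonal_apply, Matrix.one_apply]
  split_ifs <;> simp

lemma diagJ1C_toE (m : ℕ) (a b : ℝ) (z : Fin m → ℂ) :
    Matrix.toEuclideanLin (diagJ1C m a b) (toE m z) = toE m (fun k =>
      (a + b * Complex.I) * z k) := by
  rw [diagJ1C_eq]
  ext i
  obtain ⟨j, rfl⟩ := (sum2Equiv m).surjective i
  simp only [Matrix.toLpLin_apply, Matrix.mulVec, dotProduct]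
  rw [← (sum2Equiv m).sum_comp]
  rcases j with j | j <;>
  simp [toE, Matrix.fromBlocks, Matrix.one_apply, Finset.sum_add_distrib,
    add_mul, ite_mul]

section ode
attribute [local instance] Matrix.linftyOpNormedRing Matrix.linftyOpNormedAlgebra

lemma linFlow_unique (A : Matrix (Fin d) (Fin d) ℝ) (y : ℝ → Euc d)
    (hy : ∀ t, HasDerivAt y (Matrix.toEuclideanLin A (y t)) t) (t : ℝ) :
    linFlow A t (y 0) = y t := by
  have hg : ∀ t, HasDerivAt (fun t => linFlow A t (y 0))
      (Matrix.toEuclideanLin A (linFlow A t (y 0))) t := by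
    intro t
    let ev : Matrix (Fin d) (Fin d) ℝ →ₗ[ℝ] Euc d :=
      { toFun := fun M => Matrix.toEuclideanLin M (y 0)
        map_add' := fun M N => by simp
        map_smul' := fun c M => by simp }
    have h1 := hasDerivAt_exp_smul_const' (𝕂 := ℝ) A t
    have h2 := (LinearMap.toContinuousLinearMap ev).hasFDerivAt.comp_hasDerivAt t h1
    refine h2.congr_deriv ?_
    change Matrix.toEuclideanLin (A * NormedSpace.exp (t • A)) (y 0) = _
    simp [linFlow, Matrix.toLpLin_apply, Matrix.mulVec_mulVec]
  let Ac := LinearMap.toContinuousLinearMap (Matrix.toEuclideanLin A)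
  have := ODE_solution_unique_univ (v := fun _ x => Ac x) (s := fun _ => Set.univ) (K := ‖Ac‖₊)
    (f := fun t => linFlow A t (y 0)) (g := y) (t₀ := 0)
    (fun t => Ac.lipschitz.lipschitzOnWith) (fun t => ⟨hg t, trivial⟩) (fun t => ⟨hy t, trivial⟩)
    (by simp [linFlow])
  exact congrFun this t
end ode

lemma hasDerivAt_toE {m : ℕ} {z : ℝ → Fin m → ℂ} {z' : Fin m → ℂ} {t : ℝ}
    (h : ∀ k, HasDerivAt (fun t => z t k) (z' k) t) :
    HasDerivAt (fun t => toE m (z t)) (toE m z') t := by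
  have h1 : HasDerivAt z z' t := hasDerivAt_pi.2 h
  exact (LinearMap.toContinuousLinearMap (toE m).toLinearMap).hasFDerivAt.comp_hasDerivAt t h1

lemma hasDerivAt_cexp (l : ℂ) (t : ℝ) :
    HasDerivAt (fun t : ℝ => Complex.exp (l * t)) (l * Complex.exp (l * t)) t := by
  have := (((hasDerivAt_id (t : ℂ)).const_mul l).cexp).comp_ofReal
  simpa [mul_comm] using this

lemma linFlow_diag (m : ℕ) (a b t : ℝ) (z : Fin m → ℂ) :
    linFlow (diagJ1C m a b) t (toE m z)
      = toE m (Complex.exp ((a + b * Complex.I) * t) • z) := by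
  have := linFlow_unique (diagJ1C m a b)
    (fun t => toE m (Complex.exp ((a + b * Complex.I) * t) • z)) (fun t => by
      rw [diagJ1C_toE]
      refine hasDerivAt_toE fun k => ?_
      have := (hasDerivAt_cexp (a + b * Complex.I) t).mul_const (z k)
      simpa [mul_assoc] using this) t
  simpa using this

lemma dpw_deriv (n : ℕ) (t : ℝ) : HasDerivAt (dpw (n + 1)) (dpw n t) t := by
  have h := ((hasDerivAt_id (t : ℂ)).pow (n + 1)).comp_ofReal.div_const ((n + 1).factorial : ℂ)
  refine h.congr_deriv ?_
  have h1 : (n.factorial : ℂ) ≠ 0 := by exact_mod_cast n.factorial_ne_zero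
  have h2 : (n + 1 : ℂ) ≠ 0 := by exact_mod_cast n.succ_ne_zero
  simp only [dpw, Nat.factorial_succ]
  push_cast
  simp
  field_simp

lemma nilP_deriv {m : ℕ} (z : Fin m → ℂ) (k : Fin m) (t : ℝ) :
    HasDerivAt (fun t => nilP t z k)
      (∑ j : Fin m, if (k : ℕ) + 1 = j then nilP t z j else 0) t := by
  have h1 : HasDerivAt (fun t => nilP t z k)
      (∑ j : Fin m, if (k : ℕ) + 1 ≤ j then dpw (j - (k + 1)) t * z j else 0) t := by
    unfold nilP
    refine HasDerivAt.fun_sum fun j _ => ?_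
    by_cases hkj : (k : ℕ) + 1 ≤ j
    · have hle : k ≤ j := by rw [Fin.le_def]; omega
      simp only [if_pos hkj, if_pos hle]
      have e : (j : ℕ) - k = (j - (k + 1)) + 1 := by omega
      rw [e]
      exact (dpw_deriv _ t).mul_const _
    · simp only [if_neg hkj]
      by_cases hle : k ≤ j
      · have e : (j : ℕ) - k = 0 := by rw [Fin.le_def] at hle; omega
        simp only [if_pos hle, e]
        have : (fun t => dpw 0 t * z j) = fun _ => z j := by funext t; simp [dpw]
        rw [this]
        exact hasDerivAt_const _ _
      · simp only [if_neg hle]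
        exact hasDerivAt_const _ _
  refine h1.congr_deriv ?_
  by_cases hk : (k : ℕ) + 1 < m
  · have e : (∑ j : Fin m, if (k : ℕ) + 1 = j then nilP t z j else 0)
        = nilP t z ⟨k + 1, hk⟩ := by
      rw [Finset.sum_eq_single (⟨k + 1, hk⟩ : Fin m)
        (fun j _ hj => if_neg fun e => hj (Fin.ext e.symm)) (by simp)]
      simp
    rw [e]
    simp [nilP, Fin.le_def]
  · rw [Finset.sum_eq_zero, Finset.sum_eq_zero]
    · intro j _; have := j.2; rw [if_neg (by omega)]
    · intro j _; have := j.2; rw [if_neg (by omega)]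

lemma nilP_zero {m : ℕ} (z : Fin m → ℂ) : nilP 0 z = z := by
  funext k
  unfold nilP
  rw [Finset.sum_eq_single k]
  · simp [dpw]
  · intro j _ hj
    split_ifs with h
    · have : (j : ℕ) - k ≠ 0 := by
        have h1 : (k : ℕ) ≤ j := h
        have h2 : (j : ℕ) ≠ k := fun e => hj (Fin.ext e)
        omega
      simp [dpw, this]
    · rfl
  · simp

lemma linFlow_jordan (m : ℕ) (a b t : ℝ) (z : Fin m → ℂ) :
    linFlow (jordanC m a b) t (toE m z)
      = toE m (Complex.exp ((a + b * Complex.I) * t) • nilP t z) := by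
  have := linFlow_unique (jordanC m a b)
    (fun t => toE m (Complex.exp ((a + b * Complex.I) * t) • nilP t z)) (fun t => by
      rw [jordanC_toE]
      refine hasDerivAt_toE fun k => ?_
      have := (hasDerivAt_cexp (a + b * Complex.I) t).mul (nilP_deriv z k t)
      refine this.congr_deriv ?_
      simp [mul_assoc, Finset.mul_sum]) t
  simpa [nilP_zero] using this

lemma AH.of_linear {X Y : Type*} [NormedAddCommGroup X] [NormedAddCommGroup Y]
    [NormedSpace ℝ X] [NormedSpace ℝ Y] [FiniteDimensional ℝ X] (f : X →ₗ[ℝ] Y) : AH f :=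
  AH.of_lip ‖LinearMap.toContinuousLinearMap f‖ (norm_nonneg _) fun x y => by
    rw [← map_sub]
    exact (LinearMap.toContinuousLinearMap f).le_opNorm (x - y)

lemma AH.holderNearZero {f : Euc d → Euc d} (hf : AH f) {γ : ℝ} (h0 : 0 < γ) (h1 : γ < 1) :
    HolderNearZero γ f := by
  obtain ⟨K, -, h⟩ := hf γ h0 h1 1 one_pos
  refine ⟨1, one_pos, K, fun x hx y hy => ?_⟩
  rw [dist_eq_norm, dist_eq_norm]
  exact h x y (by simpa using (mem_ball_zero_iff.1 hx).le) (by simpa using (mem_ball_zero_iff.1 hy).le)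

theorem exists_homeo (m : ℕ) (a b : ℝ) (ha : a ≠ 0) :
    ∃ h : Euc (2 * m) ≃ₜ Euc (2 * m), MemH1minus h ∧ MemH1minus h.symm ∧
      ∀ (t : ℝ) (x : Euc (2 * m)),
        h (linFlow (diagJ1C m a b) t x) = linFlow (jordanC m a b) t (h x) := by
  obtain ⟨H, H0, hH, hHs, hc⟩ := exists_conj a b ha m
  have hL : AH (toE m) := AH.of_linear (toE m).toLinearMap
  have hLs : AH (toE m).symm := AH.of_linear (toE m).symm.toLinearMap
  have k1 : AH (fun x => toE m (H ((toE m).symm x))) := hL.comp (hH.comp hLs)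
  have k2 : AH (fun x => toE m (H.symm ((toE m).symm x))) := hL.comp (hHs.comp hLs)
  let h : Euc (2 * m) ≃ₜ Euc (2 * m) :=
    { toFun := fun x => toE m (H ((toE m).symm x))
      invFun := fun x => toE m (H.symm ((toE m).symm x))
      left_inv := fun x => by simp
      right_inv := fun x => by simp
      continuous_toFun := k1.continuous
      continuous_invFun := k2.continuous }
  have Hs0 : H.symm 0 = 0 := by rw [Equiv.symm_apply_eq, H0]
  have e0 : h 0 = 0 := by simp [h, H0]
  have e0' : h.symm 0 = 0 := by rw [Homeomorph.symm_apply_eq, e0]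
  refine ⟨h, fun γ g0 g1 => ⟨e0, k1.holderNearZero g0 g1, k2.holderNearZero g0 g1⟩,
    fun γ g0 g1 => ⟨e0', k2.holderNearZero g0 g1, k1.holderNearZero g0 g1⟩, fun t x => ?_⟩
  obtain ⟨z, rfl⟩ := (toE m).surjective x
  rw [linFlow_diag]
  change toE m (H ((toE m).symm (toE m _))) = linFlow _ t (toE m (H ((toE m).symm (toE m z))))
  rw [LinearEquiv.symm_apply_apply, LinearEquiv.symm_apply_apply, hc, linFlow_jordan]

/-- **Lemma 4.2**: the flows on `ℝ^{2m}` generated by `J_m(a+ib)` and by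
`diag [J_1(a+ib), …, J_1(a+ib)]` (`a, b ≠ 0`) are all-Hölder equivalent; in fact
all-Hölder conjugate via some `h ∈ 𝓗_{1⁻}` with `h (Ψ_t x) = Φ_t (h x)`. -/
theorem jordanC_allHolder_equiv_diagJ1 {m : ℕ} (hm : 0 < m) (a b : ℝ)
    (ha : a ≠ 0) (hb : b ≠ 0) :
    RelEquivWith MemH1minus (jordanC m a b) (diagJ1C m a b) ∧
    ∃ h : Euc (2 * m) ≃ₜ Euc (2 * m), MemH1minus h ∧
      ∀ (t : ℝ) (x : Euc (2 * m)),
        h (linFlow (diagJ1C m a b) t x) = linFlow (jordanC m a b) t (h x) := by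
  obtain ⟨h, h1, h2, hc⟩ := exists_homeo m a b ha
  refine ⟨⟨h.symm, h2, fun x => ?_⟩, h, h1, hc⟩
  obtain ⟨y, rfl⟩ := h.surjective x
  rw [Homeomorph.symm_apply_apply, flowOrbit, flowOrbit, ← Set.range_comp]
  congr 1
  funext t
  simp only [Function.comp_apply]
  rw [← hc, Homeomorph.symm_apply_apply]

end LF
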